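/- Let A = [y₁,y₂] ⊆ [0,1], β ∈ ℝ, and let {q_n} be a sequence of positive reals with lim_{n→∞} n(1−q_n) = β. For i ≠ j in {1,…,n}, define Cov_n( 1_A(π(i)/n), 1_A(π(j)/n) ) := E_{μ_{n,q_n}}[ 1_A(π(i)/n)·1_A(π(j)/n) ] − E_{μ_{n,q_n}}[ 1_A(π(i)/n) ]·E_{μ_{n,q_n}}[ 1_A(π(j)/n) ]. Then lim_{n→∞} max_{i≠j, i,j∈{1,…,n}} | Cov_n( 1_A(π(i)/n), 1_A(π(j)/n) ) | = 0. -/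

import Mathlib

open Filter Finset MeasureTheory

/-- Number of inversions of a permutation of `Fin n`. -/
def inversions (n : ℕ) (π : Equiv.Perm (Fin n)) : ℕ :=
  (Finset.univ.filter (fun p : Fin n × Fin n => p.1 < p.2 ∧ π p.2 < π p.1)).card

/-- The `(n,q)`-Mallows probability mass function on `S_n`. -/
noncomputable def mallowsPMF (n : ℕ) (q : ℝ) (π : Equiv.Perm (Fin n)) : ℝ :=
  q ^ inversions n π / ∑ σ : Equiv.Perm (Fin n), q ^ inversions n σ

open Classical in
/-- The `(n,q)`-Mallows probability of an event `P` of permutations. -/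
noncomputable def mallowsProb (n : ℕ) (q : ℝ) (P : Equiv.Perm (Fin n) → Prop) : ℝ :=
  ∑ π : Equiv.Perm (Fin n), if P π then mallowsPMF n q π else 0

/-- Expectation with respect to the `(n,q)`-Mallows measure. -/
noncomputable def mallowsExp (n : ℕ) (q : ℝ) (f : Equiv.Perm (Fin n) → ℝ) : ℝ :=
  ∑ π : Equiv.Perm (Fin n), mallowsPMF n q π * f π

/-- Action of a permutation of `Fin n` on one-based indices `{1,…,n}`. -/
def permAct (n : ℕ) (π : Equiv.Perm (Fin n)) (i : ℕ) : ℕ :=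
  if h : 1 ≤ i ∧ i ≤ n then ((π ⟨i - 1, by omega⟩ : Fin n) : ℕ) + 1 else i

/-- The limiting density `u(x,y,β)` from Starr's theorem. -/
noncomputable def mallowsU (x y β : ℝ) : ℝ :=
  if β = 0 then 1
  else (β / 2) * Real.sinh (β / 2) /
    (Real.exp (β / 4) * Real.cosh (β * (x - y) / 2)
      - Real.exp (-β / 4) * Real.cosh (β * (x + y - 1) / 2)) ^ 2

/-! ### Linearity and positivity of the Mallows expectation -/

lemma mallows_partition_pos (n : ℕ) {q : ℝ} (hq : 0 < q) :
    0 < ∑ σ : Equiv.Perm (Fin n), q ^ inversions n σ :=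
  Finset.sum_pos (fun _ _ => pow_pos hq _) Finset.univ_nonempty

lemma mallowsPMF_nonneg (n : ℕ) {q : ℝ} (hq : 0 < q) (π : Equiv.Perm (Fin n)) :
    0 ≤ mallowsPMF n q π :=
  div_nonneg (pow_pos hq _).le (mallows_partition_pos n hq).le

lemma mallowsPMF_sum (n : ℕ) {q : ℝ} (hq : 0 < q) :
    ∑ π : Equiv.Perm (Fin n), mallowsPMF n q π = 1 := by
  unfold mallowsPMF
  rw [← Finset.sum_div, div_self (mallows_partition_pos n hq).ne']

lemma mallowsExp_eq_div (n : ℕ) (q : ℝ) (f : Equiv.Perm (Fin n) → ℝ) :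
    mallowsExp n q f =
      (∑ π, q ^ inversions n π * f π) / ∑ σ : Equiv.Perm (Fin n), q ^ inversions n σ := by
  unfold mallowsExp mallowsPMF
  rw [Finset.sum_div]
  exact Finset.sum_congr rfl fun _ _ => by ring

lemma mallowsExp_const (n : ℕ) {q : ℝ} (hq : 0 < q) (c : ℝ) :
    mallowsExp n q (fun _ => c) = c := by
  unfold mallowsExp
  rw [← Finset.sum_mul, mallowsPMF_sum n hq, one_mul]

lemma mallowsExp_add (n : ℕ) (q : ℝ) (f g : Equiv.Perm (Fin n) → ℝ) :
    mallowsExp n q (fun π => f π + g π) = mallowsExp n q f + mallowsExp n q g := by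
  simp only [mallowsExp, mul_add, Finset.sum_add_distrib]

lemma mallowsExp_sub (n : ℕ) (q : ℝ) (f g : Equiv.Perm (Fin n) → ℝ) :
    mallowsExp n q (fun π => f π - g π) = mallowsExp n q f - mallowsExp n q g := by
  simp only [mallowsExp, mul_sub, Finset.sum_sub_distrib]

lemma mallowsExp_const_mul (n : ℕ) (q c : ℝ) (f : Equiv.Perm (Fin n) → ℝ) :
    mallowsExp n q (fun π => c * f π) = c * mallowsExp n q f := by
  unfold mallowsExp
  rw [Finset.mul_sum]
  exact Finset.sum_congr rfl fun _ _ => by ring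

lemma mallowsExp_sum {ι : Type*} (n : ℕ) (q : ℝ) (s : Finset ι)
    (f : ι → Equiv.Perm (Fin n) → ℝ) :
    mallowsExp n q (fun π => ∑ i ∈ s, f i π) = ∑ i ∈ s, mallowsExp n q (f i) := by
  simp only [mallowsExp, Finset.mul_sum]
  exact Finset.sum_comm

lemma mallowsExp_mono (n : ℕ) {q : ℝ} (hq : 0 < q) {f g : Equiv.Perm (Fin n) → ℝ}
    (h : ∀ π, f π ≤ g π) : mallowsExp n q f ≤ mallowsExp n q g :=
  Finset.sum_le_sum fun π _ => mul_le_mul_of_nonneg_left (h π) (mallowsPMF_nonneg n hq π)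

lemma abs_mallowsExp_le (n : ℕ) {q : ℝ} (hq : 0 < q) {f g : Equiv.Perm (Fin n) → ℝ}
    (h : ∀ π, |f π| ≤ g π) : |mallowsExp n q f| ≤ mallowsExp n q g := by
  refine (Finset.abs_sum_le_sum_abs _ _).trans (Finset.sum_le_sum fun π _ => ?_)
  rw [abs_mul, abs_of_nonneg (mallowsPMF_nonneg n hq π)]
  exact mul_le_mul_of_nonneg_left (h π) (mallowsPMF_nonneg n hq π)

/-- Bias-variance decomposition. -/
lemma mallowsExp_sub_sq (n : ℕ) {q : ℝ} (hq : 0 < q) (f : Equiv.Perm (Fin n) → ℝ) (c : ℝ) :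
    mallowsExp n q (fun π => (f π - c) ^ 2) =
      mallowsExp n q (fun π => (f π - mallowsExp n q f) ^ 2) + (mallowsExp n q f - c) ^ 2 := by
  have key : ∀ d, mallowsExp n q (fun π => (f π - d) ^ 2) =
      mallowsExp n q (fun π => f π ^ 2) - 2 * d * mallowsExp n q f + d ^ 2 := fun d => by
    have h : (fun π => (f π - d) ^ 2) = fun π => f π ^ 2 - 2 * d * f π + d ^ 2 :=
      funext fun _ => by ring
    rw [h, mallowsExp_add, mallowsExp_sub, mallowsExp_const_mul, mallowsExp_const n hq]
  rw [key, key]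
  ring

/-! ### Splitting off the value at the first position -/

/-- The permutation of `Fin (n + 1)` sending `0` to `a` and whose remaining values
are in the same relative order as those of `σ`. -/
def consPerm {n : ℕ} (a : Fin (n + 1)) (σ : Equiv.Perm (Fin n)) : Equiv.Perm (Fin (n + 1)) :=
  ((finSuccEquiv' 0).trans (Equiv.optionCongr σ)).trans (finSuccEquiv' a).symm

@[simp]
lemma consPerm_zero {n : ℕ} (a : Fin (n + 1)) (σ : Equiv.Perm (Fin n)) : consPerm a σ 0 = a := by
  simp [consPerm]

@[simp]
lemma consPerm_succ {n : ℕ} (a : Fin (n + 1)) (σ : Equiv.Perm (Fin n)) (i : Fin n) :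
    consPerm a σ i.succ = a.succAbove (σ i) := by
  have h : finSuccEquiv' (0 : Fin (n + 1)) i.succ = some i := by
    rw [← Fin.succAbove_zero_apply]
    exact finSuccEquiv'_succAbove 0 i
  simp [consPerm, h]

lemma consPerm_bijective (n : ℕ) :
    Function.Bijective fun p : Fin (n + 1) × Equiv.Perm (Fin n) => consPerm p.1 p.2 := by
  rw [Fintype.bijective_iff_injective_and_card]
  refine ⟨?_, by simp [Fintype.card_perm, Nat.factorial_succ]⟩
  rintro ⟨a, σ⟩ ⟨b, τ⟩ h
  have h : consPerm a σ = consPerm b τ := h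
  have hab : a = b := by simpa using congrArg (fun π => π 0) h
  subst hab
  have : σ = τ := Equiv.ext fun i => by
    simpa using congrArg (fun π => π i.succ) h
  rw [this]

lemma inversions_eq_sum (n : ℕ) (π : Equiv.Perm (Fin n)) :
    inversions n π = ∑ i, ∑ j, if i < j ∧ π j < π i then 1 else 0 := by
  rw [inversions, Finset.card_filter, ← Finset.univ_product_univ, Finset.sum_product]

lemma inversions_consPerm {n : ℕ} (a : Fin (n + 1)) (σ : Equiv.Perm (Fin n)) :
    inversions (n + 1) (consPerm a σ) = a + inversions n σ := by
  have h : ∑ i, (if a.succAbove (σ i) < a then 1 else 0) = (a : ℕ) := by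
    rw [Equiv.sum_comp σ fun v => if a.succAbove v < a then 1 else 0]
    simp_rw [Fin.succAbove_lt_iff_castSucc_lt, Fin.lt_def, Fin.val_castSucc]
    rw [← Finset.card_filter, Fin.card_filter_val_lt]
    omega
  simp only [inversions_eq_sum, Fin.sum_univ_succ, consPerm_zero, consPerm_succ,
    Fin.not_lt_zero, Fin.succ_pos, Fin.succ_lt_succ_iff, Fin.succAbove_lt_succAbove_iff,
    false_and, true_and, if_false, zero_add, h]

/-- A bound on the conditional expectations given the value at the first position. -/
lemma mallowsExp_succ_le {n : ℕ} {q : ℝ} (hq : 0 < q) {f : Equiv.Perm (Fin (n + 1)) → ℝ} {c : ℝ}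
    (h : ∀ a, mallowsExp n q (fun σ => f (consPerm a σ)) ≤ c) : mallowsExp (n + 1) q f ≤ c := by
  have key : ∀ g : Equiv.Perm (Fin (n + 1)) → ℝ, ∑ π, q ^ inversions (n + 1) π * g π =
      ∑ a : Fin (n + 1), q ^ (a : ℕ) * ∑ σ, q ^ inversions n σ * g (consPerm a σ) := fun g => by
    rw [← (consPerm_bijective n).sum_comp fun π => q ^ inversions (n + 1) π * g π,
      ← Finset.univ_product_univ, Finset.sum_product]
    simp only [inversions_consPerm, pow_add, Finset.mul_sum, mul_assoc]
  have h1 := key fun _ => 1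
  simp only [mul_one] at h1
  rw [mallowsExp_eq_div, div_le_iff₀ (mallows_partition_pos _ hq), key, h1, Finset.mul_sum]
  refine Finset.sum_le_sum fun a _ => ?_
  have ha := h a
  rw [mallowsExp_eq_div, div_le_iff₀ (mallows_partition_pos _ hq)] at ha
  calc _ ≤ q ^ (a : ℕ) * (c * ∑ σ, q ^ inversions n σ) :=
        mul_le_mul_of_nonneg_left ha (pow_pos hq _).le
    _ = _ := by ring

/-! ### Variance of interval counts -/

/-- The indicator function of the interval `[s, t)` of natural numbers. -/
def icoIndicator (s t v : ℕ) : ℝ := if s ≤ v ∧ v < t then 1 else 0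

lemma icoIndicator_nonneg (s t v : ℕ) : 0 ≤ icoIndicator s t v := by
  unfold icoIndicator; split_ifs <;> norm_num

lemma icoIndicator_le_one (s t v : ℕ) : icoIndicator s t v ≤ 1 := by
  unfold icoIndicator; split_ifs <;> norm_num

lemma icoIndicator_succAbove {n : ℕ} (s t : ℕ) (a : Fin (n + 1)) (v : Fin n) :
    icoIndicator s t (a.succAbove v) =
      icoIndicator (if (a : ℕ) < s then s - 1 else s) (if (a : ℕ) < t then t - 1 else t) v := by
  unfold icoIndicator Fin.succAbove
  simp only [Fin.lt_def, Fin.val_castSucc]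
  congr 1
  split_ifs <;> simp only [Fin.val_castSucc, Fin.val_succ, eq_iff_iff] <;> omega

lemma abs_icoIndicator_succAbove_sub_le {n : ℕ} (s t : ℕ) (a : Fin (n + 1)) (v : Fin n) :
    |icoIndicator s t (a.succAbove v) - icoIndicator s t v| ≤
      (if (v : ℕ) + 1 = s then 1 else 0) + (if (v : ℕ) + 1 = t then 1 else 0) := by
  have hv : ((a.succAbove v : Fin (n + 1)) : ℕ) = v ∨
      ((a.succAbove v : Fin (n + 1)) : ℕ) = v + 1 := by
    unfold Fin.succAbove
    split_ifs <;> simp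
  unfold icoIndicator
  rcases hv with hv | hv <;> rw [hv] <;> split_ifs <;> first | omega | norm_num

lemma sum_val_succ_eq_le_one (n s : ℕ) :
    ∑ v : Fin n, (if (v : ℕ) + 1 = s then (1 : ℝ) else 0) ≤ 1 := by
  rw [← Finset.sum_filter, Finset.sum_const, nsmul_eq_mul, mul_one]
  exact_mod_cast Finset.card_le_one.2 fun x hx y hy => by
    simp only [Finset.mem_filter, Finset.mem_univ, true_and] at hx hy
    exact Fin.ext (by omega)

lemma abs_weighted_sum_succAbove_sub_le {n : ℕ} (s t : ℕ) (a : Fin (n + 1))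
    (σ : Equiv.Perm (Fin n)) (c : Fin n → ℝ) (hc : ∀ i, |c i| ≤ 1) :
    |∑ i, c i * icoIndicator s t (a.succAbove (σ i)) - ∑ i, c i * icoIndicator s t (σ i)| ≤ 2 := by
  rw [← Finset.sum_sub_distrib]
  calc _ ≤ ∑ i, |c i * icoIndicator s t (a.succAbove (σ i)) - c i * icoIndicator s t (σ i)| :=
        Finset.abs_sum_le_sum_abs _ _
    _ ≤ ∑ i, ((if (σ i : ℕ) + 1 = s then (1 : ℝ) else 0) +
          (if (σ i : ℕ) + 1 = t then 1 else 0)) := by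
        refine Finset.sum_le_sum fun i _ => ?_
        rw [← mul_sub, abs_mul]
        exact (mul_le_of_le_one_left (abs_nonneg _) (hc i)).trans
          (abs_icoIndicator_succAbove_sub_le s t a (σ i))
    _ = ∑ v : Fin n, ((if (v : ℕ) + 1 = s then (1 : ℝ) else 0) +
          (if (v : ℕ) + 1 = t then 1 else 0)) :=
        Equiv.sum_comp σ fun v : Fin n => ((if (v : ℕ) + 1 = s then (1 : ℝ) else 0) +
          (if (v : ℕ) + 1 = t then 1 else 0))
    _ ≤ 2 := by
        rw [Finset.sum_add_distrib]
        linarith [sum_val_succ_eq_le_one n s, sum_val_succ_eq_le_one n t]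

/-- The variance of a weighted count of the positions whose value lies in an interval
grows at most linearly in `n`, whatever the parameter `q`. -/
lemma mallows_variance_le {q : ℝ} (hq : 0 < q) (n s t : ℕ) (c : Fin n → ℝ)
    (hc : ∀ i, |c i| ≤ 1) :
    mallowsExp n q (fun π => (∑ i, c i * icoIndicator s t (π i) -
      mallowsExp n q (fun π => ∑ i, c i * icoIndicator s t (π i))) ^ 2) ≤ 9 * n := by
  induction n generalizing s t with
  | zero => simp [mallowsExp_const 0 hq]
  | succ n ih =>
    set S : Equiv.Perm (Fin n) → ℝ := fun σ => ∑ i, c i.succ * icoIndicator s t (σ i) with hS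
    refine (le_add_of_nonneg_right (sq_nonneg
      (mallowsExp (n + 1) q (fun π => ∑ i, c i * icoIndicator s t (π i)) -
        mallowsExp n q S))).trans ?_
    rw [← mallowsExp_sub_sq (n + 1) hq]
    refine mallowsExp_succ_le hq fun a => ?_
    set T : Equiv.Perm (Fin n) → ℝ := fun σ => ∑ i, c i.succ * icoIndicator s t (a.succAbove (σ i))
      with hT
    have hvar : mallowsExp n q (fun σ => (T σ - mallowsExp n q T) ^ 2) ≤ 9 * n := by
      have := ih (if (a : ℕ) < s then s - 1 else s) (if (a : ℕ) < t then t - 1 else t)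
        (fun i => c i.succ) fun i => hc _
      simpa only [hT, icoIndicator_succAbove] using this
    have hTS : |mallowsExp n q T - mallowsExp n q S| ≤ 2 := by
      rw [← mallowsExp_sub, ← mallowsExp_const n hq 2]
      exact abs_mallowsExp_le n hq fun σ =>
        abs_weighted_sum_succAbove_sub_le s t a σ _ fun i => hc _
    have h0 : |c 0 * icoIndicator s t a| ≤ 1 := by
      rw [abs_mul, abs_of_nonneg (icoIndicator_nonneg s t a)]
      exact mul_le_one₀ (hc 0) (icoIndicator_nonneg s t a) (icoIndicator_le_one s t a)
    have hfun : (fun σ => (∑ i, c i * icoIndicator s t (consPerm a σ i) - mallowsExp n q S) ^ 2) =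
        fun σ => (T σ - (mallowsExp n q S - c 0 * icoIndicator s t a)) ^ 2 := by
      funext σ
      simp only [Fin.sum_univ_succ, consPerm_zero, consPerm_succ, hT]
      ring
    rw [hfun, mallowsExp_sub_sq n hq]
    have hsq : (mallowsExp n q T - (mallowsExp n q S - c 0 * icoIndicator s t a)) ^ 2 ≤ 9 := by
      rw [abs_le] at hTS h0
      nlinarith
    push_cast
    linarith

/-! ### Effect of a transposition of positions -/

lemma inversions_mul_swap_le {n : ℕ} (π : Equiv.Perm (Fin n)) {i j : Fin n} (hij : i ≤ j) :
    inversions n (π * Equiv.swap i j) ≤ inversions n π + 2 * (j - i : ℕ) := by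
  classical
  set τ := Equiv.swap i j with hτ
  have hsub : (Finset.univ.filter fun p : Fin n × Fin n => p.1 < p.2 ∧ (π * τ) p.2 < (π * τ) p.1) ⊆
      (Finset.univ.filter fun p : Fin n × Fin n => p.1 < p.2 ∧ π p.2 < π p.1).image
          (fun p => (τ p.1, τ p.2)) ∪
        (({i} : Finset (Fin n)) ×ˢ Finset.Ioc i j ∪ Finset.Ico i j ×ˢ ({j} : Finset (Fin n))) := by
    rw [Finset.subset_iff]
    rintro ⟨a, b⟩ hp
    replace hp := (Finset.mem_filter.1 hp).2
    simp only [Finset.mem_union, Finset.mem_image, Finset.mem_filter, Finset.mem_univ, true_and,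
      Finset.mem_product, Finset.mem_singleton, Finset.mem_Ioc, Finset.mem_Ico]
    by_cases h : τ a < τ b
    · exact Or.inl ⟨(τ a, τ b), ⟨h, hp.2⟩, by simp [hτ]⟩
    · right
      have hab := hp.1
      simp only [hτ, Equiv.swap_apply_def] at h
      split_ifs at h <;> grind
  refine (Finset.card_le_card hsub).trans ((Finset.card_union_le _ _).trans ?_)
  refine add_le_add Finset.card_image_le ((Finset.card_union_le _ _).trans ?_)
  simp only [Finset.card_product, Finset.card_singleton, Fin.card_Ioc, Fin.card_Ico]
  omega

lemma inversions_mul_swap_le_of_dist_le {n d : ℕ} (π : Equiv.Perm (Fin n)) {i j : Fin n}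
    (hij : (i : ℕ) ≤ j + d) (hji : (j : ℕ) ≤ i + d) :
    inversions n (π * Equiv.swap i j) ≤ inversions n π + 2 * d := by
  rcases le_total i j with h | h
  · have := inversions_mul_swap_le π h
    omega
  · have := inversions_mul_swap_le π h
    rw [Equiv.swap_comm] at this
    omega

/-- Powers with exponents differing by at most `d` are close when `q` and `q⁻¹` are at most `Q`. -/
lemma abs_pow_sub_pow_le_of_exponents_close {q Q : ℝ} (hq : 0 < q) (hQ : q ≤ Q) (hQ' : q⁻¹ ≤ Q)
    {k l d : ℕ} (hkl : k ≤ l + d) (hlk : l ≤ k + d) : |q ^ l - q ^ k| ≤ (Q ^ d - 1) * q ^ k := by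
  have hQ1 : 1 ≤ Q := by
    rcases le_total 1 q with h | h
    · exact h.trans hQ
    · exact ((one_le_inv₀ hq).2 h).trans hQ'
  have key : ∀ k l : ℕ, k ≤ l + d → l ≤ k + d → q ^ l ≤ Q ^ d * q ^ k := fun k l h1 h2 => by
    rcases le_total k l with h | h
    · obtain ⟨e, rfl⟩ := Nat.exists_eq_add_of_le h
      rw [pow_add, mul_comm]
      refine mul_le_mul_of_nonneg_right ?_ (pow_pos hq _).le
      exact (pow_le_pow_left₀ hq.le hQ e).trans (pow_le_pow_right₀ hQ1 (by omega))
    · obtain ⟨e, rfl⟩ := Nat.exists_eq_add_of_le h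
      have h3 : q ^ l = q⁻¹ ^ e * q ^ (l + e) := by
        rw [pow_add, inv_pow]; field_simp
      rw [h3]
      refine mul_le_mul_of_nonneg_right ?_ (pow_pos hq _).le
      exact (pow_le_pow_left₀ (inv_pos.2 hq).le hQ' e).trans (pow_le_pow_right₀ hQ1 (by omega))
  have hd : 1 ≤ Q ^ d := one_le_pow₀ hQ1
  have h1 := key k l hkl hlk
  have h2 := key l k hlk hkl
  have hk := pow_pos hq k
  have hl := pow_pos hq l
  rw [abs_le]
  constructor
  · rcases le_total (q ^ k) (q ^ l) with h | h
    · nlinarith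
    · nlinarith
  · linarith

lemma abs_mallowsExp_mul_swap_sub_le {n d : ℕ} {q Q : ℝ} (hq : 0 < q) (hQ : q ≤ Q)
    (hQ' : q⁻¹ ≤ Q) {i j : Fin n} (hij : (i : ℕ) ≤ j + d) (hji : (j : ℕ) ≤ i + d)
    {f : Equiv.Perm (Fin n) → ℝ} (hf : ∀ π, |f π| ≤ 1) :
    |mallowsExp n q (fun π => f (π * Equiv.swap i j)) - mallowsExp n q f| ≤ Q ^ (2 * d) - 1 := by
  have hZ := mallows_partition_pos n hq
  have hshift : ∑ π, q ^ inversions n π * f (π * Equiv.swap i j) =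
      ∑ π, q ^ inversions n (π * Equiv.swap i j) * f π := by
    rw [← Equiv.sum_comp (Equiv.mulRight (Equiv.swap i j))]
    simp [mul_assoc]
  rw [mallowsExp_eq_div, mallowsExp_eq_div, ← sub_div, abs_div, abs_of_pos hZ, div_le_iff₀ hZ,
    hshift, ← Finset.sum_sub_distrib, Finset.mul_sum]
  refine (Finset.abs_sum_le_sum_abs _ _).trans (Finset.sum_le_sum fun π _ => ?_)
  rw [← sub_mul, abs_mul]
  refine (mul_le_of_le_one_right (abs_nonneg _) (hf π)).trans ?_
  refine abs_pow_sub_pow_le_of_exponents_close hq hQ hQ' ?_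
    (inversions_mul_swap_le_of_dist_le π hij hji)
  have := inversions_mul_swap_le_of_dist_le (π * Equiv.swap i j) hij hji
  simpa [mul_assoc] using this

/-! ### Covariances -/

/-- The covariance of the indicators that the values at `i` and `j` lie in `[s, t)`. -/
noncomputable def mallowsCov (n : ℕ) (q : ℝ) (s t : ℕ) (i j : Fin n) : ℝ :=
  mallowsExp n q (fun π => icoIndicator s t (π i) * icoIndicator s t (π j)) -
    mallowsExp n q (fun π => icoIndicator s t (π i)) *
      mallowsExp n q (fun π => icoIndicator s t (π j))

lemma mallowsExp_icoIndicator_mem {n : ℕ} {q : ℝ} (hq : 0 < q) (s t : ℕ) (i : Fin n) :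
    0 ≤ mallowsExp n q (fun π => icoIndicator s t (π i)) ∧
      mallowsExp n q (fun π => icoIndicator s t (π i)) ≤ 1 := by
  constructor
  · rw [← mallowsExp_const n hq 0]
    exact mallowsExp_mono n hq fun π => icoIndicator_nonneg _ _ _
  · rw [← mallowsExp_const n hq 1]
    exact mallowsExp_mono n hq fun π => icoIndicator_le_one _ _ _

lemma abs_mallowsCov_le_one {n : ℕ} {q : ℝ} (hq : 0 < q) (s t : ℕ) (i j : Fin n) :
    |mallowsCov n q s t i j| ≤ 1 := by
  have h0 : 0 ≤ mallowsExp n q (fun π => icoIndicator s t (π i) * icoIndicator s t (π j)) := by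
    rw [← mallowsExp_const n hq 0]
    exact mallowsExp_mono n hq fun π =>
      mul_nonneg (icoIndicator_nonneg _ _ _) (icoIndicator_nonneg _ _ _)
  have h1 : mallowsExp n q (fun π => icoIndicator s t (π i) * icoIndicator s t (π j)) ≤ 1 := by
    rw [← mallowsExp_const n hq 1]
    exact mallowsExp_mono n hq fun π =>
      mul_le_one₀ (icoIndicator_le_one _ _ _) (icoIndicator_nonneg _ _ _) (icoIndicator_le_one _ _ _)
  obtain ⟨hi0, hi1⟩ := mallowsExp_icoIndicator_mem hq s t i
  obtain ⟨hj0, hj1⟩ := mallowsExp_icoIndicator_mem hq s t j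
  have h2 := mul_nonneg hi0 hj0
  have h3 := mul_le_one₀ hi1 hj0 hj1
  unfold mallowsCov
  rw [abs_le]
  constructor <;> linarith

lemma abs_mallowsCov_sub_le {n d : ℕ} {q Q : ℝ} (hq : 0 < q) (hQ : q ≤ Q) (hQ' : q⁻¹ ≤ Q)
    (s t : ℕ) {i k j : Fin n} (hik : (i : ℕ) ≤ k + d) (hki : (k : ℕ) ≤ i + d)
    (hij : i ≠ j) (hkj : k ≠ j) :
    |mallowsCov n q s t i j - mallowsCov n q s t k j| ≤ 2 * (Q ^ (2 * d) - 1) := by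
  have hF := abs_mallowsExp_mul_swap_sub_le hq hQ hQ' hki hik
    (f := fun π => icoIndicator s t (π k) * icoIndicator s t (π j)) fun π => by
      rw [abs_of_nonneg (mul_nonneg (icoIndicator_nonneg _ _ _) (icoIndicator_nonneg _ _ _))]
      exact mul_le_one₀ (icoIndicator_le_one _ _ _) (icoIndicator_nonneg _ _ _)
        (icoIndicator_le_one _ _ _)
  have hG := abs_mallowsExp_mul_swap_sub_le hq hQ hQ' hki hik
    (f := fun π => icoIndicator s t (π k)) fun π => by
      rw [abs_of_nonneg (icoIndicator_nonneg _ _ _)]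
      exact icoIndicator_le_one _ _ _
  simp only [Equiv.Perm.mul_apply, Equiv.swap_apply_left,
    Equiv.swap_apply_of_ne_of_ne hkj.symm hij.symm] at hF hG
  obtain ⟨hj0, hj1⟩ := mallowsExp_icoIndicator_mem hq s t j
  have hG' := (abs_mul _ _).trans_le ((mul_le_of_le_one_right (abs_nonneg _)
    ((abs_of_nonneg hj0).trans_le hj1)).trans hG)
  unfold mallowsCov
  rw [abs_le] at *
  constructor <;> nlinarith

lemma abs_sum_mallowsCov_le {n : ℕ} (hn : 0 < n) {q : ℝ} (hq : 0 < q) (s t : ℕ)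
    (I : Finset (Fin n)) (j : Fin n) : |∑ i ∈ I, mallowsCov n q s t i j| ≤ 5 * √n := by
  classical
  set c : Fin n → ℝ := fun i => if i ∈ I then 1 else 0 with hc
  set S : Equiv.Perm (Fin n) → ℝ := fun π => ∑ i, c i * icoIndicator s t (π i) with hS
  have hSI : S = fun π => ∑ i ∈ I, icoIndicator s t (π i) := by
    funext π; simp [hS, hc]
  have hvar := mallows_variance_le hq n s t c fun i => by
    simp only [hc]; split_ifs <;> simp
  have hsum : ∑ i ∈ I, mallowsCov n q s t i j =
      mallowsExp n q (fun π => (S π - mallowsExp n q S) * icoIndicator s t (π j)) := by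
    simp only [sub_mul, mallowsExp_sub, mallowsExp_const_mul]
    simp only [hSI, mallowsCov, Finset.sum_sub_distrib, mallowsExp_sum, Finset.sum_mul]
  have hr : 0 < √(n : ℝ) := Real.sqrt_pos.2 (by exact_mod_cast hn)
  have hrr : √(n : ℝ) * √(n : ℝ) = n := Real.mul_self_sqrt (Nat.cast_nonneg n)
  rw [hsum]
  calc _ ≤ mallowsExp n q (fun π => (2 * √n)⁻¹ * (S π - mallowsExp n q S) ^ 2 + √n / 2) := by
        refine abs_mallowsExp_le n hq fun π => ?_
        rw [abs_mul, abs_of_nonneg (icoIndicator_nonneg _ _ _)]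
        refine (mul_le_of_le_one_right (abs_nonneg _) (icoIndicator_le_one _ _ _)).trans ?_
        rw [← sq_abs]
        have := sq_nonneg (|S π - mallowsExp n q S| - √n)
        rw [← mul_le_mul_iff_right₀ (mul_pos two_pos hr)]
        field_simp
        nlinarith
    _ = (2 * √n)⁻¹ * mallowsExp n q (fun π => (S π - mallowsExp n q S) ^ 2) + √n / 2 := by
        rw [mallowsExp_add, mallowsExp_const_mul, mallowsExp_const n hq]
    _ ≤ (2 * √n)⁻¹ * (9 * n) + √n / 2 := by gcongr
    _ = 5 * √n := by
        rw [show (9 : ℝ) * n = 9 * (√n * √n) by rw [hrr]]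
        field_simp
        ring

/-- A block of `m` consecutive positions containing a given one. -/
lemma exists_block {n m : ℕ} (hmn : m ≤ n) (i : Fin n) :
    ∃ I : Finset (Fin n), I.card = m ∧ ∀ k ∈ I, (i : ℕ) ≤ k + m ∧ (k : ℕ) ≤ i + m := by
  have hi := i.2
  let f : Fin m → Fin n := fun k => ⟨min (i : ℕ) (n - m) + k, by omega⟩
  have hf : Function.Injective f := fun a b h => by
    simp only [f, Fin.mk.injEq, Nat.add_left_cancel_iff] at h
    exact Fin.ext h
  refine ⟨Finset.univ.map ⟨f, hf⟩, by simp, fun k hk => ?_⟩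
  obtain ⟨a, -, rfl⟩ := Finset.mem_map.1 hk
  simp only [Function.Embedding.coeFn_mk, f]
  omega

lemma mul_abs_mallowsCov_le {n m : ℕ} (hn : 0 < n) (hmn : m ≤ n) {q Q : ℝ} (hq : 0 < q)
    (hQ : q ≤ Q) (hQ' : q⁻¹ ≤ Q) (hQ1 : 1 ≤ Q) (s t : ℕ) {i j : Fin n} (hij : i ≠ j) :
    m * |mallowsCov n q s t i j| ≤ m * (2 * (Q ^ (2 * m) - 1)) + 2 + 5 * √n := by
  obtain ⟨I, hI, hd⟩ := exists_block hmn i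
  have hdiff : ∑ k ∈ I, |mallowsCov n q s t i j - mallowsCov n q s t k j| ≤
      ∑ k ∈ I, (2 * (Q ^ (2 * m) - 1) + if k = j then 2 else 0) := by
    refine Finset.sum_le_sum fun k hk => ?_
    split_ifs with hkj
    · have h1 := abs_mallowsCov_le_one hq s t i j
      have h2 := abs_mallowsCov_le_one hq s t k j
      have h3 : 1 ≤ Q ^ (2 * m) := one_le_pow₀ hQ1
      linarith [abs_sub (mallowsCov n q s t i j) (mallowsCov n q s t k j)]
    · rw [add_zero]
      exact abs_mallowsCov_sub_le hq hQ hQ' s t (hd k hk).1 (hd k hk).2 hij hkj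
  have hrhs : ∑ k ∈ I, (2 * (Q ^ (2 * m) - 1) + if k = j then (2 : ℝ) else 0) ≤
      m * (2 * (Q ^ (2 * m) - 1)) + 2 := by
    rw [Finset.sum_add_distrib, Finset.sum_const, hI, nsmul_eq_mul, Finset.sum_ite_eq']
    split_ifs <;> linarith
  have hsum := abs_sum_mallowsCov_le hn hq s t I j
  have hsplit : (m : ℝ) * mallowsCov n q s t i j =
      ∑ k ∈ I, (mallowsCov n q s t i j - mallowsCov n q s t k j) +
        ∑ k ∈ I, mallowsCov n q s t k j := by
    rw [Finset.sum_sub_distrib, Finset.sum_const, hI, nsmul_eq_mul]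
    ring
  calc _ = |(m : ℝ) * mallowsCov n q s t i j| := by rw [abs_mul, Nat.abs_cast]
    _ ≤ _ := by
      rw [hsplit]
      exact (abs_add_le _ _).trans (add_le_add
        ((Finset.abs_sum_le_sum_abs _ _).trans (hdiff.trans hrhs)) hsum)

lemma mallowsProb_eq_mallowsExp (n : ℕ) (q : ℝ) {P : Equiv.Perm (Fin n) → Prop}
    {f : Equiv.Perm (Fin n) → ℝ} (h : ∀ π, (P π → f π = 1) ∧ (¬ P π → f π = 0)) :
    mallowsProb n q P = mallowsExp n q f := by
  unfold mallowsProb mallowsExp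
  refine Finset.sum_congr rfl fun π _ => ?_
  split_ifs with hP
  · rw [(h π).1 hP, mul_one]
  · rw [(h π).2 hP, mul_zero]

lemma cast_succ_div_mem_Icc_iff {n : ℕ} (hn : 0 < n) {y₁ y₂ : ℝ} (hy₂ : 0 ≤ y₂) (v : ℕ) :
    ((v + 1 : ℕ) : ℝ) / n ∈ Set.Icc y₁ y₂ ↔ ⌈y₁ * n⌉₊ - 1 ≤ v ∧ v < ⌊y₂ * n⌋₊ := by
  have hn' : (0 : ℝ) < n := by exact_mod_cast hn
  rw [Set.mem_Icc, le_div_iff₀ hn', div_le_iff₀ hn', ← Nat.ceil_le,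
    ← Nat.le_floor_iff (by positivity), tsub_le_iff_right, Nat.succ_le_iff]

lemma mallowsProb_cov_eq_mallowsCov {n : ℕ} (hn : 0 < n) (q : ℝ) {y₁ y₂ : ℝ} (hy₂ : 0 ≤ y₂)
    {i j : ℕ} (hi : 1 ≤ i ∧ i ≤ n) (hj : 1 ≤ j ∧ j ≤ n) :
    mallowsProb n q (fun π => (permAct n π i : ℝ) / n ∈ Set.Icc y₁ y₂ ∧
            (permAct n π j : ℝ) / n ∈ Set.Icc y₁ y₂)
        - mallowsProb n q (fun π => (permAct n π i : ℝ) / n ∈ Set.Icc y₁ y₂)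
          * mallowsProb n q (fun π => (permAct n π j : ℝ) / n ∈ Set.Icc y₁ y₂) =
      mallowsCov n q (⌈y₁ * n⌉₊ - 1) ⌊y₂ * n⌋₊ ⟨i - 1, by omega⟩ ⟨j - 1, by omega⟩ := by
  have hact : ∀ k (hk : 1 ≤ k ∧ k ≤ n) (π : Equiv.Perm (Fin n)),
      (permAct n π k : ℝ) / n ∈ Set.Icc y₁ y₂ ↔
        ⌈y₁ * n⌉₊ - 1 ≤ (π ⟨k - 1, by omega⟩ : ℕ) ∧ (π ⟨k - 1, by omega⟩ : ℕ) < ⌊y₂ * n⌋₊ :=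
    fun k hk π => by
      rw [permAct, dif_pos hk]
      exact cast_succ_div_mem_Icc_iff hn hy₂ _
  simp only [hact i hi, hact j hj]
  unfold mallowsCov
  congr 1
  · exact mallowsProb_eq_mallowsExp n q fun π => by
      unfold icoIndicator
      constructor
      · rintro ⟨h1, h2⟩
        rw [if_pos h1, if_pos h2, one_mul]
      · intro h
        rw [not_and_or] at h
        rcases h with h | h <;> rw [if_neg h] <;> simp
  · congr 1 <;> exact mallowsProb_eq_mallowsExp n q fun π =>
      ⟨fun h => if_pos h, fun h => if_neg h⟩

/-- **Lemma 4.2.** Let `A = [y₁,y₂] ⊆ [0,1]` and `n(1-qₙ) → β`. Then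
`max_{i ≠ j} | Cov_n( 1_A(π(i)/n), 1_A(π(j)/n) ) | → 0`; i.e. the covariances tend to `0`
uniformly over pairs `i ≠ j` in `{1,…,n}`. -/
theorem mallows_covariance_uniform_convergence
    (y₁ y₂ : ℝ) (hy₁ : 0 ≤ y₁) (hy₁₂ : y₁ ≤ y₂) (hy₂ : y₂ ≤ 1) (β : ℝ)
    (q : ℕ → ℝ) (hq : ∀ n, 0 < q n)
    (hβ : Tendsto (fun n : ℕ => (n : ℝ) * (1 - q n)) atTop (nhds β)) :
    ∀ ε > (0 : ℝ), ∃ N : ℕ, ∀ n ≥ N, ∀ i ∈ Finset.Icc 1 n, ∀ j ∈ Finset.Icc 1 n, i ≠ j →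
      |mallowsProb n (q n) (fun π =>
            (permAct n π i : ℝ) / n ∈ Set.Icc y₁ y₂ ∧
            (permAct n π j : ℝ) / n ∈ Set.Icc y₁ y₂)
        - mallowsProb n (q n) (fun π => (permAct n π i : ℝ) / n ∈ Set.Icc y₁ y₂)
          * mallowsProb n (q n) (fun π => (permAct n π j : ℝ) / n ∈ Set.Icc y₁ y₂)| < ε := by
  intro ε hε
  have hC : 0 < |β| + 1 := by positivity
  set C := |β| + 1 with hCdef
  set w : ℕ → ℝ := fun n => √√(n : ℝ) with hw
  have hw_top : Tendsto w atTop atTop :=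
    Real.tendsto_sqrt_atTop.comp (Real.tendsto_sqrt_atTop.comp tendsto_natCast_atTop_atTop)
  have hbound : Tendsto (fun n => 2 * (Real.exp (8 * C * (w n)⁻¹) - 1) + 7 * (w n)⁻¹) atTop
      (nhds 0) := by
    have h := tendsto_inv_atTop_zero.comp hw_top
    have h1 : Continuous fun x : ℝ => 2 * (Real.exp (8 * C * x) - 1) + 7 * x := by fun_prop
    simpa [Function.comp_def] using (h1.tendsto 0).comp h
  have hev : ∀ᶠ n : ℕ in atTop, |(n : ℝ) * (1 - q n)| < C :=
    hβ.abs.eventually_lt_const (lt_add_one _)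
  have hlarge : ∀ᶠ n : ℕ in atTop, 2 * C ≤ (n : ℝ) :=
    tendsto_natCast_atTop_atTop.eventually_ge_atTop _
  obtain ⟨N, hN⟩ := eventually_atTop.1 (hev.and (hlarge.and
    ((hbound.eventually_lt_const hε).and (hw_top.eventually_ge_atTop 1))))
  refine ⟨N, fun n hn i hi j hj hij => ?_⟩
  obtain ⟨hqC, hnC, hlt, hw1⟩ := hN n hn
  rw [Finset.mem_Icc] at hi hj
  have hn0 : 0 < n := by omega
  have hnR : (0 : ℝ) < n := by exact_mod_cast hn0
  rw [mallowsProb_cov_eq_mallowsCov hn0 (q n) (hy₁.trans hy₁₂) hi hj]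
  refine lt_of_le_of_lt ?_ hlt
  have hsq : √(n : ℝ) = w n ^ 2 := (Real.sq_sqrt (Real.sqrt_nonneg _)).symm
  have hpow : (n : ℝ) = w n ^ 4 := by
    rw [show w n ^ 4 = (w n ^ 2) ^ 2 by ring, ← hsq, Real.sq_sqrt hnR.le]
  have hw0 : 0 < w n := by linarith
  set x : ℝ := C / n with hx
  have hx0 : 0 < x := div_pos hC hnR
  have hx2 : x ≤ 1 / 2 := by rw [hx, div_le_iff₀ hnR]; linarith
  have hqx : |1 - q n| ≤ x := by
    rw [hx, le_div_iff₀ hnR, mul_comm]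
    rw [abs_mul, Nat.abs_cast] at hqC
    exact hqC.le
  rw [abs_le] at hqx
  have hQ : q n ≤ 1 + 2 * x := by linarith
  have hQ' : (q n)⁻¹ ≤ 1 + 2 * x := by
    rw [inv_le_iff_one_le_mul₀ (hq n)]
    nlinarith
  set m : ℕ := ⌈w n ^ 3⌉₊ with hm
  have hm_ge : w n ^ 3 ≤ m := Nat.le_ceil _
  have hw3 : 1 ≤ w n ^ 3 := one_le_pow₀ hw1
  have hm_le : (m : ℝ) ≤ 2 * w n ^ 3 := by
    linarith [Nat.ceil_lt_add_one (zero_le_one.trans hw3)]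
  have hmn : m ≤ n := by
    rw [hm, Nat.ceil_le, hpow]
    exact pow_le_pow_right₀ hw1 (by norm_num)
  have hm0 : (0 : ℝ) < m := by linarith
  have hmain := mul_abs_mallowsCov_le hn0 hmn (hq n) hQ hQ' (by linarith) (⌈y₁ * n⌉₊ - 1)
    ⌊y₂ * n⌋₊ (i := ⟨i - 1, by omega⟩) (j := ⟨j - 1, by omega⟩) fun h => hij (by
      rw [Fin.mk.injEq] at h
      omega)
  have hexp : (1 + 2 * x) ^ (2 * m) ≤ Real.exp (8 * C * (w n)⁻¹) := by
    calc (1 + 2 * x) ^ (2 * m) ≤ Real.exp (2 * x) ^ (2 * m) := by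
          refine pow_le_pow_left₀ (by linarith) ?_ _
          linarith [Real.add_one_le_exp (2 * x)]
      _ = Real.exp (4 * x * m) := by
          rw [← Real.exp_nat_mul]
          push_cast
          ring_nf
      _ ≤ Real.exp (4 * x * (2 * w n ^ 3)) := by gcongr
      _ = Real.exp (8 * C * (w n)⁻¹) := by
          rw [hx, hpow]
          congr 1
          field_simp
          ring
  have hrest : 2 + 5 * √(n : ℝ) ≤ m * (7 * (w n)⁻¹) := by
    have h1 : w n ^ 2 ≤ m * (w n)⁻¹ := by
      rw [← div_eq_mul_inv, le_div_iff₀ hw0, ← pow_succ]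
      exact hm_ge
    have h2 : 1 ≤ w n ^ 2 := one_le_pow₀ hw1
    rw [hsq]
    linarith
  refine le_of_mul_le_mul_left ?_ hm0
  calc _ ≤ _ := hmain
    _ ≤ m * (2 * (Real.exp (8 * C * (w n)⁻¹) - 1)) + m * (7 * (w n)⁻¹) := by
        rw [add_assoc]
        gcongr
    _ = _ := by ring
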